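/- Suppose 0 < p < 3/4. Then S_n/√n converges in distribution, as n → ∞, to R·Z, where Z is a centered Gaussian random variable with variance 1/(3−4p) independent of R; equivalently, the limit distribution function is x ↦ ∫_{ℝ∖{0}} Φ_{0,1/(3−4p)}(x/|t|) dF_R(t) + P(R = 0)·1_{[0,∞)}(x), where Φ_{0,σ²} denotes the N(0,σ²) distribution function and F_R the distribution function of R. Moreover, if E(R²) < ∞, then E(S_n/√n) → 0 and E((S_n/√n)²) → E(R²)/(3−4p) as n → ∞. -/

import Mathlib

open MeasureTheory ProbabilityTheory Filter Topology

noncomputable section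

/-- The σ-algebra generated by the steps `X 1, …, X n`. -/
def sigmaUpTo {Ω : Type*} (X : ℕ → Ω → ℝ) (n : ℕ) : MeasurableSpace Ω :=
  ⨆ i ∈ Finset.Icc 1 n, MeasurableSpace.comap (X i) inferInstance

/-- The σ-algebra generated by all the steps `X 1, X 2, …`. -/
def sigmaAll {Ω : Type*} (X : ℕ → Ω → ℝ) : MeasurableSpace Ω :=
  ⨆ i ∈ Set.Ici 1, MeasurableSpace.comap (X i) inferInstance

/-- The partial sum `X 1 + ⋯ + X n` of the walk. -/
def partialSum {Ω : Type*} (X : ℕ → Ω → ℝ) (n : ℕ) (ω : Ω) : ℝ :=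
  ∑ k ∈ Finset.Icc 1 n, X k ω

/-- Convergence in distribution of the random variables `f n` to the law `ν`,
expressed as weak convergence tested against bounded continuous functions. -/
def TendstoInDistribution {Ω : Type*} [MeasurableSpace Ω] (μ : Measure Ω)
    (f : ℕ → Ω → ℝ) (ν : Measure ℝ) : Prop :=
  ∀ g : BoundedContinuousFunction ℝ ℝ,
    Tendsto (fun n => ∫ ω, g (f n ω) ∂μ) atTop (𝓝 (∫ x, g x ∂ν))

/-- A nonnegative sequence with `e (n+1) ≤ (1 - κ/(n+1)) e n + o(1/(n+1))` tends to zero. -/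
lemma tendsto_zero_of_eventually_le_contraction {e δ : ℕ → ℝ} {κ : ℝ} (hκ : 0 < κ)
    (he : ∀ n, 0 ≤ e n) (hδ : Tendsto δ atTop (𝓝 0))
    (h : ∀ᶠ n : ℕ in atTop, e (n + 1) ≤ (1 - κ / (n + 1)) * e n + δ n / (n + 1)) :
    Tendsto e atTop (𝓝 0) := by
  rw [Metric.tendsto_atTop]
  intro η hη
  have hδ' : ∀ᶠ n : ℕ in atTop, δ n ≤ κ * (η / 2) :=
    hδ.eventually_le_const (by positivity)
  have hbig : ∀ᶠ n : ℕ in atTop, κ ≤ (n : ℝ) := tendsto_natCast_atTop_atTop.eventually_ge_atTop κ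
  obtain ⟨N, hN⟩ := eventually_atTop.1 (h.and (hδ'.and hbig))
  let H : ℕ → ℝ := fun n => ∑ i ∈ Finset.range n, (1 / (i + 1) : ℝ)
  let f : ℕ → ℝ := fun n => max (e n - η / 2) 0
  have hstep : ∀ n, N ≤ n → f (n + 1) ≤ Real.exp (-(κ / (n + 1))) * f n := by
    intro n hn
    obtain ⟨h1, h2, h3⟩ := hN n hn
    have hn1 : (0 : ℝ) < n + 1 := by positivity
    have hc : 0 ≤ 1 - κ / (n + 1) := by
      rw [sub_nonneg, div_le_one hn1]; linarith
    have hf0 : 0 ≤ f n := le_max_right _ _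
    have hdiv : δ n / (n + 1) ≤ κ / (n + 1) * (η / 2) := by
      rw [div_mul_eq_mul_div]; gcongr
    have hle : f (n + 1) ≤ (1 - κ / (n + 1)) * f n := by
      refine max_le ?_ (mul_nonneg hc hf0)
      have := mul_le_mul_of_nonneg_left (le_max_left (e n - η / 2) 0) hc
      change _ ≤ (1 - κ / (n + 1)) * max (e n - η / 2) 0
      linarith
    exact hle.trans (mul_le_mul_of_nonneg_right (Real.one_sub_le_exp_neg _) hf0)
  have hbound : ∀ n, N ≤ n → f n ≤ f N * Real.exp (κ * H N) * Real.exp (-(κ * H n)) := by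
    intro n hn
    induction n, hn using Nat.le_induction with
    | base => rw [mul_assoc, ← Real.exp_add]; simp
    | succ n hn ih =>
      have hH : H (n + 1) = H n + 1 / (n + 1) := Finset.sum_range_succ _ _
      calc f (n + 1) ≤ Real.exp (-(κ / (n + 1))) * f n := hstep n hn
        _ ≤ Real.exp (-(κ / (n + 1))) *
            (f N * Real.exp (κ * H N) * Real.exp (-(κ * H n))) := by gcongr
        _ = f N * Real.exp (κ * H N) * Real.exp (-(κ * H (n + 1))) := by
          rw [hH, show -(κ * (H n + 1 / ((n : ℝ) + 1))) = -(κ / (n + 1)) + -(κ * H n) by ring,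
            Real.exp_add]
          ring
  have hlim : Tendsto (fun n => f N * Real.exp (κ * H N) * Real.exp (-(κ * H n))) atTop (𝓝 0) := by
    have : Tendsto (fun n => Real.exp (-(κ * H n))) atTop (𝓝 0) :=
      Real.tendsto_exp_neg_atTop_nhds_zero.comp
        (Real.tendsto_sum_range_one_div_nat_succ_atTop.const_mul_atTop hκ)
    simpa using this.const_mul (f N * Real.exp (κ * H N))
  obtain ⟨M, hM⟩ := eventually_atTop.1 (hlim.eventually_lt_const (half_pos hη))
  refine ⟨max N M, fun n hn => ?_⟩
  have h1 := (hbound n (le_of_max_le_left hn)).trans_lt (hM n (le_of_max_le_right hn))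
  have h2 := le_max_left (e n - η / 2) 0
  rw [Real.dist_eq, sub_zero, abs_of_nonneg (he n)]
  linarith

/-- The characteristic function of a sign with mean `y` is close to that of `N(y, 1)`. -/
lemma norm_cos_add_sin_sub_exp_le {t y : ℝ} (hy : |y| ≤ 1) :
    ‖(Real.cos t + y * Real.sin t * Complex.I : ℂ) -
      Complex.exp (t * y * Complex.I) * (Real.exp (-(t ^ 2 / 2)) : ℂ)‖ ≤
        3 * (t ^ 2 * y ^ 2 + |t| ^ 3) := by
  have hE1 : Real.exp (-(t ^ 2 / 2)) ≤ 1 := Real.exp_le_one_iff.2 (by linarith [sq_nonneg t])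
  have hE0 := Real.exp_pos (-(t ^ 2 / 2))
  have hexp : ‖Complex.exp (t * y * Complex.I)‖ = 1 := by
    exact_mod_cast Complex.norm_exp_ofReal_mul_I (t * y)
  rcases le_or_gt |t| 1 with ht | ht
  · set E := Real.exp (-(t ^ 2 / 2)) with hE
    have hs0 := abs_nonneg t
    have hsq : t ^ 2 = |t| ^ 2 := (sq_abs t).symm
    have hs4 : |t| ^ 4 ≤ |t| ^ 3 := pow_le_pow_of_le_one hs0 ht (by norm_num)
    have hs5 : |t| ^ 5 ≤ |t| ^ 3 := pow_le_pow_of_le_one hs0 ht (by norm_num)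
    have hs2 : |t| ^ 2 ≤ 1 := pow_le_one₀ hs0 ht
    have hEb : |E - 1 + t ^ 2 / 2| ≤ |t| ^ 4 / 4 := by
      have := Real.abs_exp_sub_one_sub_id_le (x := -(t ^ 2 / 2))
        (by rw [abs_neg, abs_of_nonneg (by positivity), hsq]; linarith)
      calc |E - 1 + t ^ 2 / 2| = |E - 1 - -(t ^ 2 / 2)| := by ring_nf
        _ ≤ (-(t ^ 2 / 2)) ^ 2 := this
        _ = |t| ^ 4 / 4 := by rw [hsq]; ring
    have hcos : |Real.cos t - E| ≤ |t| ^ 3 := by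
      have h1 := Real.cos_bound ht
      rw [abs_le] at h1 hEb ⊢
      constructor <;> linarith [h1.1, h1.2, hEb.1, hEb.2, pow_nonneg hs0 4]
    have hsin : |y * (Real.sin t - t)| ≤ |t| ^ 3 := by
      have h1 := Real.sin_bound ht
      have h3 : |t ^ 3 / 6| = |t| ^ 3 / 6 := by rw [abs_div, abs_pow]; norm_num
      have h2 : |Real.sin t - t| ≤ |t| ^ 3 := by
        calc |Real.sin t - t| = |(Real.sin t - (t - t ^ 3 / 6)) - t ^ 3 / 6| := by ring_nf
          _ ≤ |Real.sin t - (t - t ^ 3 / 6)| + |t ^ 3 / 6| := abs_sub _ _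
          _ ≤ |t| ^ 3 := by linarith [pow_nonneg hs0 3]
      rw [abs_mul]
      exact (mul_le_of_le_one_left (abs_nonneg _) hy).trans h2
    have hlin : |t * y * (E - 1)| ≤ |t| ^ 3 := by
      have h1 : |E - 1| ≤ |t| ^ 2 := by
        rw [abs_le] at hEb ⊢
        have : |t| ^ 4 ≤ |t| ^ 2 := pow_le_pow_of_le_one hs0 ht (by norm_num)
        constructor <;> linarith [hEb.1, hEb.2]
      calc |t * y * (E - 1)| = |t| * |y| * |E - 1| := by rw [abs_mul, abs_mul]
        _ ≤ |t| * 1 * |t| ^ 2 := by gcongr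
        _ = |t| ^ 3 := by ring
    have hquad : ‖Complex.exp (t * y * Complex.I) - 1 - t * y * Complex.I‖ ≤ t ^ 2 * y ^ 2 := by
      have hn : ‖(t * y * Complex.I : ℂ)‖ = |t| * |y| := by simp
      have := Complex.norm_exp_sub_one_sub_id_le (x := (t * y * Complex.I : ℂ))
        (by rw [hn]; exact mul_le_one₀ ht (abs_nonneg _) hy)
      rwa [hn, mul_pow, sq_abs, sq_abs] at this
    have hdecomp : (Real.cos t + y * Real.sin t * Complex.I : ℂ) -
        Complex.exp (t * y * Complex.I) * (E : ℂ) =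
        ((Real.cos t - E : ℝ) : ℂ) + ((y * (Real.sin t - t) : ℝ) : ℂ) * Complex.I
        - (E : ℂ) * (Complex.exp (t * y * Complex.I) - 1 - t * y * Complex.I)
        - ((t * y * (E - 1) : ℝ) : ℂ) * Complex.I := by
      push_cast; ring
    rw [hdecomp]
    have n1 : ‖((Real.cos t - E : ℝ) : ℂ)‖ ≤ |t| ^ 3 := by
      rw [Complex.norm_real]; exact hcos
    have n2 : ‖((y * (Real.sin t - t) : ℝ) : ℂ) * Complex.I‖ ≤ |t| ^ 3 := by
      rw [norm_mul, Complex.norm_I, mul_one, Complex.norm_real]; exact hsin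
    have n3 : ‖(E : ℂ) * (Complex.exp (t * y * Complex.I) - 1 - t * y * Complex.I)‖
        ≤ t ^ 2 * y ^ 2 := by
      rw [norm_mul, Complex.norm_real, Real.norm_of_nonneg hE0.le]
      exact (mul_le_of_le_one_left (norm_nonneg _) hE1).trans hquad
    have n4 : ‖((t * y * (E - 1) : ℝ) : ℂ) * Complex.I‖ ≤ |t| ^ 3 := by
      rw [norm_mul, Complex.norm_I, mul_one, Complex.norm_real]; exact hlin
    have htri := (norm_sub_le _ _).trans (add_le_add (norm_sub_le _ _) le_rfl) |>.trans
      (add_le_add (add_le_add (norm_add_le _ _) le_rfl) le_rfl) |>.trans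
      (add_le_add (add_le_add (add_le_add n1 n2) n3) n4)
    nlinarith [mul_nonneg (sq_nonneg t) (sq_nonneg y)]
  · have h1 : ‖(Real.cos t : ℂ)‖ ≤ 1 := by
      rw [Complex.norm_real]; exact Real.abs_cos_le_one t
    have h2 : ‖(y * Real.sin t * Complex.I : ℂ)‖ ≤ 1 := by
      rw [norm_mul, norm_mul, Complex.norm_I, mul_one, Complex.norm_real, Complex.norm_real]
      exact mul_le_one₀ hy (norm_nonneg _) (Real.abs_sin_le_one t)
    have h3 : ‖Complex.exp (t * y * Complex.I) * (Real.exp (-(t ^ 2 / 2)) : ℂ)‖ ≤ 1 := by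
      rw [norm_mul, hexp, one_mul, Complex.norm_real, Real.norm_of_nonneg hE0.le]; exact hE1
    have h4 : 1 ≤ |t| ^ 3 := one_le_pow₀ ht.le
    have := (norm_sub_le _ _).trans (add_le_add (norm_add_le _ _) le_rfl) |>.trans
      (add_le_add (add_le_add h1 h2) h3)
    nlinarith [mul_nonneg (sq_nonneg t) (sq_nonneg y)]

lemma abs_exp_neg_sub_exp_neg_le {u v : ℝ} (hu : 0 ≤ u) (hv : 0 ≤ v) :
    |Real.exp (-u) - Real.exp (-v)| ≤ |u - v| := by
  wlog huv : u ≤ v generalizing u v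
  · rw [abs_sub_comm, abs_sub_comm u]
    exact this hv hu (le_of_not_ge huv)
  rw [abs_of_nonneg (sub_nonneg.2 (Real.exp_le_exp.2 (neg_le_neg huv))), abs_sub_comm,
    abs_of_nonneg (sub_nonneg.2 huv)]
  have h1 := Real.one_sub_le_exp_neg (v - u)
  have h2 : Real.exp (-v) = Real.exp (-u) * Real.exp (-(v - u)) := by
    rw [← Real.exp_add]; ring_nf
  have h3 : Real.exp (-u) ≤ 1 := Real.exp_le_one_iff.2 (by linarith)
  rw [h2]
  nlinarith [Real.exp_pos (-u)]

/-- The walk with steps `X 1, X 2, …` has memory parameter `a`: the steps are signs, the first one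
is `1`, and the conditional mean of each later step is `a` times the average of the previous ones. -/
structure IsElephantWalk {Ω : Type*} [MeasurableSpace Ω] (μ : Measure Ω) (a : ℝ)
    (X : ℕ → Ω → ℝ) : Prop where
  measurable : ∀ i, Measurable (X i)
  sign : ∀ i, 1 ≤ i → ∀ᵐ ω ∂μ, X i ω = 1 ∨ X i ω = -1
  first_step : ∀ᵐ ω ∂μ, X 1 ω = 1
  condExp_step : ∀ n, 1 ≤ n →
    μ[X (n + 1) | sigmaUpTo X n] =ᵐ[μ] fun ω => a * partialSum X n ω / n

lemma partialSum_succ {Ω : Type*} (X : ℕ → Ω → ℝ) (n : ℕ) (ω : Ω) :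
    partialSum X (n + 1) ω = partialSum X n ω + X (n + 1) ω :=
  Finset.sum_Icc_succ_top (by omega) _

lemma measurable_partialSum_sigmaUpTo {Ω : Type*} (X : ℕ → Ω → ℝ) (n : ℕ) :
    Measurable[sigmaUpTo X n] (partialSum X n) := by
  refine Finset.measurable_fun_sum _ fun i hi => ?_
  exact (comap_measurable (X i)).mono
    (le_iSup₂_of_le (f := fun i _ => MeasurableSpace.comap (X i) inferInstance) i hi le_rfl) le_rfl

lemma measurable_partialSum_sigmaAll {Ω : Type*} (X : ℕ → Ω → ℝ) (n : ℕ) :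
    Measurable[sigmaAll X] (partialSum X n) := by
  refine Finset.measurable_fun_sum _ fun i hi => ?_
  exact (comap_measurable (X i)).mono
    (le_iSup₂_of_le (f := fun i _ => MeasurableSpace.comap (X i) inferInstance) i
      (Finset.mem_Icc.1 hi).1 le_rfl) le_rfl

lemma sigmaUpTo_le {Ω : Type*} [m : MeasurableSpace Ω] {X : ℕ → Ω → ℝ}
    (hX : ∀ i, Measurable (X i)) (n : ℕ) : sigmaUpTo X n ≤ m :=
  iSup₂_le fun i _ => (hX i).comap_le

namespace IsElephantWalk

variable {Ω : Type*} [MeasurableSpace Ω] {μ : Measure Ω} {a : ℝ}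
  {X : ℕ → Ω → ℝ}

lemma measurable_partialSum (hX : IsElephantWalk μ a X) (n : ℕ) : Measurable (partialSum X n) :=
  (measurable_partialSum_sigmaUpTo X n).mono (sigmaUpTo_le hX.measurable n) le_rfl

lemma abs_partialSum_le (hX : IsElephantWalk μ a X) (n : ℕ) :
    ∀ᵐ ω ∂μ, |partialSum X n ω| ≤ n := by
  have h : ∀ᵐ ω ∂μ, ∀ i, 1 ≤ i → X i ω = 1 ∨ X i ω = -1 := by
    refine ae_all_iff.2 fun i => ?_
    by_cases hi : 1 ≤ i
    · filter_upwards [hX.sign i hi] with ω hω _ using hω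
    · exact Eventually.of_forall fun ω h => absurd h hi
  filter_upwards [h] with ω hω
  calc |partialSum X n ω| ≤ ∑ k ∈ Finset.Icc 1 n, |X k ω| := Finset.abs_sum_le_sum_abs _ _
    _ = ∑ k ∈ Finset.Icc 1 n, (1 : ℝ) := Finset.sum_congr rfl fun k hk => by
        rcases hω k (Finset.mem_Icc.1 hk).1 with h | h <;> simp [h]
    _ = n := by simp

variable [IsProbabilityMeasure μ]

lemma integrable_comp {E : Type*} [NormedAddCommGroup E] [SecondCountableTopology E]
    (hX : IsElephantWalk μ a X) (n : ℕ) {g : ℝ → E} (hg : Continuous g) :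
    Integrable (fun ω => g (partialSum X n ω)) μ := by
  obtain ⟨C, hC⟩ := (isCompact_Icc (a := -(n : ℝ)) (b := n)).exists_bound_of_continuousOn
    hg.continuousOn
  refine Integrable.of_bound
    (hg.comp_stronglyMeasurable (hX.measurable_partialSum n).stronglyMeasurable).aestronglyMeasurable
    C ?_
  filter_upwards [hX.abs_partialSum_le n] with ω hω using hC _ (abs_le.1 hω)

lemma integrable_comp_mul_step {𝕜 : Type*} [RCLike 𝕜]
    (hX : IsElephantWalk μ a X) (n : ℕ) {g : ℝ → 𝕜} (hg : Continuous g) :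
    Integrable (fun ω => g (partialSum X n ω) * (X (n + 1) ω : 𝕜)) μ := by
  refine (hX.integrable_comp n hg).mul_bdd (c := 1)
    (RCLike.continuous_ofReal.comp_stronglyMeasurable
      (hX.measurable (n + 1)).stronglyMeasurable).aestronglyMeasurable ?_
  filter_upwards [hX.sign (n + 1) (by omega)] with ω hω
  rcases hω with h | h <;> simp [h]

lemma integral_comp_mul_step (hX : IsElephantWalk μ a X) {n : ℕ} (hn : 1 ≤ n) {g : ℝ → ℝ}
    (hg : Continuous g) :
    ∫ ω, g (partialSum X n ω) * X (n + 1) ω ∂μ =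
      ∫ ω, g (partialSum X n ω) * (a * partialSum X n ω / n) ∂μ := by
  have hle := sigmaUpTo_le hX.measurable n
  have hint : Integrable (fun ω => g (partialSum X n ω) * X (n + 1) ω) μ :=
    hX.integrable_comp_mul_step n hg
  have hstep : Integrable (X (n + 1)) μ := by
    simpa using hX.integrable_comp_mul_step n (continuous_const (y := (1 : ℝ)))
  have hpull := condExp_mul_of_stronglyMeasurable_left (μ := μ) (m := sigmaUpTo X n)
    (hg.comp_stronglyMeasurable (measurable_partialSum_sigmaUpTo X n).stronglyMeasurable)
    hint hstep
  rw [← integral_condExp hle]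
  refine integral_congr_ae ?_
  filter_upwards [hpull, hX.condExp_step n hn] with ω h1 h2
  exact h1.trans (congrArg (g (partialSum X n ω) * ·) h2)

lemma integral_comp_mul_step_complex (hX : IsElephantWalk μ a X) {n : ℕ} (hn : 1 ≤ n)
    {g : ℝ → ℂ} (hg : Continuous g) :
    ∫ ω, g (partialSum X n ω) * (X (n + 1) ω : ℂ) ∂μ =
      ∫ ω, g (partialSum X n ω) * ((a * partialSum X n ω / n : ℝ) : ℂ) ∂μ := by
  have h1 : Integrable (fun ω => g (partialSum X n ω) * (X (n + 1) ω : ℂ)) μ :=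
    hX.integrable_comp_mul_step n hg
  have h2 : Integrable (fun ω => g (partialSum X n ω) * ((a * partialSum X n ω / n : ℝ) : ℂ)) μ :=
    hX.integrable_comp n (g := fun s => g s * ((a * s / n : ℝ) : ℂ)) (by fun_prop)
  have hre := hX.integral_comp_mul_step hn (Complex.continuous_re.comp hg)
  have him := hX.integral_comp_mul_step hn (Complex.continuous_im.comp hg)
  apply Complex.ext
  · rw [← Complex.reCLM_apply, ← Complex.reCLM_apply, ← Complex.reCLM.integral_comp_comm h1,
      ← Complex.reCLM.integral_comp_comm h2]
    simpa only [Complex.reCLM_apply, Complex.re_mul_ofReal, Function.comp_apply] using hre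
  · rw [← Complex.imCLM_apply, ← Complex.imCLM_apply, ← Complex.imCLM.integral_comp_comm h1,
      ← Complex.imCLM.integral_comp_comm h2]
    simpa only [Complex.imCLM_apply, Complex.im_mul_ofReal, Function.comp_apply] using him

lemma integral_partialSum_succ (hX : IsElephantWalk μ a X) {n : ℕ} (hn : 1 ≤ n) :
    ∫ ω, partialSum X (n + 1) ω ∂μ = (1 + a / n) * ∫ ω, partialSum X n ω ∂μ := by
  have h1 : Integrable (fun ω => partialSum X n ω) μ := hX.integrable_comp n continuous_id
  have h2 : Integrable (X (n + 1)) μ := by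
    simpa using hX.integrable_comp_mul_step n (continuous_const (y := (1 : ℝ)))
  have h3 := hX.integral_comp_mul_step hn (continuous_const (y := (1 : ℝ)))
  simp only [one_mul] at h3
  simp_rw [partialSum_succ]
  rw [integral_add h1 h2, h3, integral_div, integral_const_mul]
  ring

lemma integral_partialSum_sq_succ (hX : IsElephantWalk μ a X) {n : ℕ} (hn : 1 ≤ n) :
    ∫ ω, partialSum X (n + 1) ω ^ 2 ∂μ = (1 + 2 * a / n) * ∫ ω, partialSum X n ω ^ 2 ∂μ + 1 := by
  have h1 : Integrable (fun ω => partialSum X n ω ^ 2) μ :=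
    hX.integrable_comp n (continuous_pow 2)
  have h2 : Integrable (fun ω => partialSum X n ω * X (n + 1) ω) μ :=
    hX.integrable_comp_mul_step n continuous_id
  have h3 := hX.integral_comp_mul_step hn continuous_id
  have h12 : Integrable
      (fun ω => partialSum X n ω ^ 2 + 2 * (partialSum X n ω * X (n + 1) ω)) μ :=
    h1.add (h2.const_mul 2)
  have h4 : ∫ ω, partialSum X (n + 1) ω ^ 2 ∂μ =
      ∫ ω, (partialSum X n ω ^ 2 + 2 * (partialSum X n ω * X (n + 1) ω)) + 1 ∂μ := by
    refine integral_congr_ae ?_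
    filter_upwards [hX.sign (n + 1) (by omega)] with ω hω
    rw [partialSum_succ]
    rcases hω with h | h <;> rw [h] <;> ring
  have h5 : ∫ ω, partialSum X n ω * (a * partialSum X n ω / n) ∂μ =
      a / n * ∫ ω, partialSum X n ω ^ 2 ∂μ := by
    rw [← integral_const_mul]
    exact integral_congr_ae (Eventually.of_forall fun ω => by ring)
  simp only [id_eq] at h3
  rw [h4, integral_add h12 (integrable_const 1),
    integral_add h1 (h2.const_mul 2), integral_const_mul, h3, h5]
  simp only [integral_const, probReal_univ, smul_eq_mul]
  ring

/-- One step of the walk acts on the characteristic function, up to a small error, as a rescaling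
followed by the addition of an independent standard Gaussian. -/
lemma norm_charFun_succ_sub_le (hX : IsElephantWalk μ a X) (ha : |a| ≤ 1) {n : ℕ} (hn : 1 ≤ n)
    (t : ℝ) :
    ‖charFun (μ.map (partialSum X (n + 1))) t -
      charFun (μ.map (partialSum X n)) (t * (1 + a / n)) * (Real.exp (-(t ^ 2 / 2)) : ℂ)‖ ≤
      3 * (t ^ 2 * (a ^ 2 * (∫ ω, partialSum X n ω ^ 2 ∂μ) / n ^ 2) + |t| ^ 3) := by
  have hn0 : (0 : ℝ) < n := by exact_mod_cast hn
  have hchar : ∀ k s, charFun (μ.map (partialSum X k)) s =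
      ∫ ω, Complex.exp (s * partialSum X k ω * Complex.I) ∂μ := fun k s => by
    rw [charFun_apply_real, integral_map (hX.measurable_partialSum k).aemeasurable
      (Continuous.aestronglyMeasurable (by fun_prop))]
  have hg : Continuous fun s : ℝ => Complex.exp (t * s * Complex.I) := by fun_prop
  have hsucc : charFun (μ.map (partialSum X (n + 1))) t =
      ∫ ω, Complex.exp (t * partialSum X n ω * Complex.I) *
        (Real.cos t + (a * partialSum X n ω / n : ℝ) * Real.sin t * Complex.I) ∂μ := by
    have i1 : Integrable (fun ω => Complex.exp (t * partialSum X n ω * Complex.I)) μ :=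
      hX.integrable_comp n hg
    have i2 : Integrable
        (fun ω => Complex.exp (t * partialSum X n ω * Complex.I) * (X (n + 1) ω : ℂ)) μ :=
      hX.integrable_comp_mul_step n hg
    have i3 : Integrable (fun ω => Complex.exp (t * partialSum X n ω * Complex.I) *
        ((a * partialSum X n ω / n : ℝ) : ℂ)) μ :=
      hX.integrable_comp n
        (g := fun s => Complex.exp (t * s * Complex.I) * ((a * s / n : ℝ) : ℂ)) (by fun_prop)
    calc charFun (μ.map (partialSum X (n + 1))) t
        = ∫ ω, Complex.exp (t * partialSum X n ω * Complex.I) * (Real.cos t : ℂ) +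
            Complex.exp (t * partialSum X n ω * Complex.I) * (X (n + 1) ω : ℂ) *
              (Real.sin t * Complex.I) ∂μ := by
          rw [hchar]
          refine integral_congr_ae ?_
          filter_upwards [hX.sign (n + 1) (by omega)] with ω hω
          have hstep : Complex.exp (t * X (n + 1) ω * Complex.I) =
              Real.cos t + X (n + 1) ω * (Real.sin t * Complex.I) := by
            rcases hω with h | h
            · simp [h, Complex.exp_mul_I]
            · rw [h, show (t * ((-1 : ℝ) : ℂ) * Complex.I) = (-t : ℂ) * Complex.I by simp,
                Complex.exp_mul_I]
              simp
          rw [partialSum_succ, Complex.ofReal_add, mul_add, add_mul, Complex.exp_add, hstep]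
          ring
      _ = _ := by
          rw [integral_add (i1.mul_const _) (i2.mul_const _), integral_mul_const,
            integral_mul_const, hX.integral_comp_mul_step_complex hn hg, ← integral_mul_const,
            ← integral_mul_const, ← integral_add (i1.mul_const _) (i3.mul_const _)]
          exact integral_congr_ae (Eventually.of_forall fun ω => by ring)
  have hresc : charFun (μ.map (partialSum X n)) (t * (1 + a / n)) *
      (Real.exp (-(t ^ 2 / 2)) : ℂ) =
      ∫ ω, Complex.exp (t * partialSum X n ω * Complex.I) *
        (Complex.exp (t * (a * partialSum X n ω / n : ℝ) * Complex.I) *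
          (Real.exp (-(t ^ 2 / 2)) : ℂ)) ∂μ := by
    rw [hchar, ← integral_mul_const]
    refine integral_congr_ae (Eventually.of_forall fun ω => ?_)
    simp only
    rw [← mul_assoc, ← Complex.exp_add]
    congr 2
    push_cast
    ring
  have j1 : Integrable (fun ω => Complex.exp (t * partialSum X n ω * Complex.I) *
        (Real.cos t + (a * partialSum X n ω / n : ℝ) * Real.sin t * Complex.I)) μ :=
    hX.integrable_comp n (g := fun s => Complex.exp (t * s * Complex.I) *
        (Real.cos t + (a * s / n : ℝ) * Real.sin t * Complex.I)) (by fun_prop)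
  have j2 : Integrable (fun ω => Complex.exp (t * partialSum X n ω * Complex.I) *
        (Complex.exp (t * (a * partialSum X n ω / n : ℝ) * Complex.I) *
          (Real.exp (-(t ^ 2 / 2)) : ℂ))) μ :=
    hX.integrable_comp n (g := fun s => Complex.exp (t * s * Complex.I) *
        (Complex.exp (t * (a * s / n : ℝ) * Complex.I) * (Real.exp (-(t ^ 2 / 2)) : ℂ)))
      (by fun_prop)
  have hsq : Integrable (fun ω => partialSum X n ω ^ 2) μ :=
    hX.integrable_comp n (continuous_pow 2)
  rw [hsucc, hresc, ← integral_sub j1 j2]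
  calc _ ≤ ∫ ω, 3 * (t ^ 2 * (a ^ 2 / n ^ 2)) * partialSum X n ω ^ 2 + 3 * |t| ^ 3 ∂μ := by
        refine norm_integral_le_of_norm_le ((hsq.const_mul _).add (integrable_const _)) ?_
        filter_upwards [hX.abs_partialSum_le n] with ω hω
        have hy : |a * partialSum X n ω / n| ≤ 1 := by
          rw [abs_div, abs_mul, Nat.abs_cast, div_le_one hn0]
          exact (mul_le_of_le_one_left (abs_nonneg _) ha).trans hω
        have hexp : ‖Complex.exp (t * partialSum X n ω * Complex.I)‖ = 1 := by
          exact_mod_cast Complex.norm_exp_ofReal_mul_I (t * partialSum X n ω)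
        rw [← mul_sub, norm_mul, hexp, one_mul]
        refine (norm_cos_add_sin_sub_exp_le hy).trans_eq ?_
        ring
    _ = _ := by
        rw [integral_add (hsq.const_mul _) (integrable_const _), integral_const_mul]
        simp only [integral_const, probReal_univ, smul_eq_mul]
        ring

lemma tendsto_integral_partialSum_sq_div (hX : IsElephantWalk μ a X) (ha : a < 1 / 2) :
    Tendsto (fun n : ℕ => (∫ ω, partialSum X n ω ^ 2 ∂μ) / n) atTop (𝓝 (1 / (1 - 2 * a))) := by
  have hL : 0 < 1 - 2 * a := by linarith
  rw [tendsto_iff_dist_tendsto_zero]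
  refine tendsto_zero_of_eventually_le_contraction (δ := fun _ => 0) hL (fun n => dist_nonneg)
    tendsto_const_nhds ?_
  filter_upwards [eventually_ge_atTop 1,
    tendsto_natCast_atTop_atTop.eventually_ge_atTop (-(2 * a))] with n hn hna
  have hn0 : (0 : ℝ) < n := by exact_mod_cast hn
  have hc : 0 ≤ 1 - (1 - 2 * a) / ((n : ℝ) + 1) := by
    rw [sub_nonneg, div_le_one (by positivity)]; linarith
  rw [zero_div, add_zero, Real.dist_eq, Real.dist_eq, ← abs_of_nonneg hc, ← abs_mul,
    hX.integral_partialSum_sq_succ hn]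
  refine le_of_eq (congrArg abs ?_)
  push_cast
  field_simp
  ring

end IsElephantWalk

/-- The scaling factor relating `√(n+1)`-normalisation after a step to `√n`-normalisation before. -/
def elephantScale (a : ℝ) (n : ℕ) : ℝ := (1 + a / n) * (√n / √(n + 1))

lemma elephantScale_nonneg {a : ℝ} (ha : -1 ≤ a) {n : ℕ} (hn : 1 ≤ n) : 0 ≤ elephantScale a n := by
  have hn1 : (1 : ℝ) ≤ n := by exact_mod_cast hn
  have : -1 ≤ a / n := by
    rw [le_div_iff₀ (by linarith)]; linarith
  exact mul_nonneg (by linarith) (by positivity)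

lemma one_sub_elephantScale_sq (a : ℝ) {n : ℕ} (hn : 1 ≤ n) :
    1 - elephantScale a n ^ 2 = ((1 - 2 * a) - a ^ 2 / n) / (n + 1) := by
  have hn0 : (0 : ℝ) < n := by exact_mod_cast hn
  rw [elephantScale, mul_pow, div_pow, Real.sq_sqrt hn0.le, Real.sq_sqrt (by positivity)]
  field_simp
  ring

lemma eventually_elephantScale_le {a : ℝ} (ha : a < 1 / 2) :
    ∀ᶠ n : ℕ in atTop, elephantScale a n ≤ 1 - (1 - 2 * a) / 4 / (n + 1) := by
  have hL : 0 < 1 - 2 * a := by linarith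
  have hlim : Tendsto (fun n : ℕ => a ^ 2 / (n : ℝ)) atTop (𝓝 0) :=
    tendsto_const_div_atTop_nhds_zero_nat _
  filter_upwards [eventually_ge_atTop 1, hlim.eventually_le_const (half_pos hL)] with n hn h
  have h1 := one_sub_elephantScale_sq a hn
  have h2 : (1 - 2 * a) / 2 / ((n : ℝ) + 1) ≤ ((1 - 2 * a) - a ^ 2 / n) / (n + 1) := by
    gcongr; linarith
  have h3 : (1 - 2 * a) / 4 / ((n : ℝ) + 1) = (1 - 2 * a) / 2 / ((n : ℝ) + 1) / 2 := by ring
  nlinarith [sq_nonneg (elephantScale a n - 1)]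

namespace IsElephantWalk

variable {Ω : Type*} [MeasurableSpace Ω] {μ : Measure Ω} [IsProbabilityMeasure μ] {a : ℝ}
  {X : ℕ → Ω → ℝ}

lemma tendsto_integral_partialSum_div_sqrt (hX : IsElephantWalk μ a X) (ha1 : -1 ≤ a)
    (ha : a < 1 / 2) :
    Tendsto (fun n : ℕ => (∫ ω, partialSum X n ω ∂μ) / √n) atTop (𝓝 0) := by
  rw [tendsto_zero_iff_abs_tendsto_zero]
  refine tendsto_zero_of_eventually_le_contraction (δ := fun _ => 0) (κ := (1 - 2 * a) / 4)
    (by linarith) (fun n => abs_nonneg _) tendsto_const_nhds ?_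
  filter_upwards [eventually_ge_atTop 1, eventually_elephantScale_le ha] with n hn h
  have hn0 : (0 : ℝ) < √n := Real.sqrt_pos.2 (by exact_mod_cast hn)
  have heq : (∫ ω, partialSum X (n + 1) ω ∂μ) / √((n + 1 : ℕ) : ℝ) =
      elephantScale a n * ((∫ ω, partialSum X n ω ∂μ) / √n) := by
    rw [hX.integral_partialSum_succ hn, elephantScale]
    push_cast
    field_simp
  simp only [Function.comp_apply]
  rw [zero_div, add_zero, heq, abs_mul, abs_of_nonneg (elephantScale_nonneg ha1 hn)]
  gcongr

/-- One step of the comparison of the normalised characteristic function with the Gaussian. -/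
lemma norm_charFun_div_sqrt_succ_sub_le (hX : IsElephantWalk μ a X) (ha1 : -1 ≤ a)
    (ha : a < 1 / 2) {n : ℕ} (hn : 1 ≤ n) {e : ℝ} (he : 0 ≤ e)
    (h : ∀ x : ℝ, ‖charFun (μ.map (partialSum X n)) (x / √n) -
      (Real.exp (-(1 / (1 - 2 * a) * x ^ 2 / 2)) : ℂ)‖ ≤ e * (|x| + |x| ^ 3)) (x : ℝ) :
    ‖charFun (μ.map (partialSum X (n + 1))) (x / √(n + 1 : ℕ)) -
      (Real.exp (-(1 / (1 - 2 * a) * x ^ 2 / 2)) : ℂ)‖ ≤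
      (max (elephantScale a n) (elephantScale a n ^ 3) * e +
        (3 * (a ^ 2 * ((∫ ω, partialSum X n ω ^ 2 ∂μ) / n * (1 / n))) + 3 * (1 / √(n + 1)) +
          1 / (1 - 2 * a) * a ^ 2 * (1 / n)) / (n + 1)) * (|x| + |x| ^ 3) := by
  have hL : 0 < 1 - 2 * a := by linarith
  have hn0 : (0 : ℝ) < n := by exact_mod_cast hn
  have hs0 : 0 < √(n : ℝ) := Real.sqrt_pos.2 hn0
  have hs1 : 0 < √((n : ℝ) + 1) := Real.sqrt_pos.2 (by positivity)
  have hs2 : √((n : ℝ) + 1) ^ 2 = n + 1 := Real.sq_sqrt (by positivity)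
  have hr0 := elephantScale_nonneg ha1 hn
  have hr := one_sub_elephantScale_sq a hn
  set L := 1 / (1 - 2 * a) with hLdef
  have hL0 : 0 < L := by positivity
  set r := elephantScale a n with hrdef
  set m := ∫ ω, partialSum X n ω ^ 2 ∂μ
  have hm0 : 0 ≤ m := integral_nonneg fun ω => sq_nonneg _
  set t := x / √((n : ℝ) + 1) with ht
  have htr : t * (1 + a / n) = r * x / √n := by
    rw [ht, hrdef, elephantScale]; field_simp
  have ht2 : t ^ 2 = x ^ 2 / (n + 1) := by rw [ht, div_pow, hs2]
  have ht3 : |t| ^ 3 = |x| ^ 3 * (1 / √((n : ℝ) + 1)) / (n + 1) := by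
    have : |x| ^ 3 / √((n : ℝ) + 1) ^ 3 =
        |x| ^ 3 * (1 / √((n : ℝ) + 1)) / √((n : ℝ) + 1) ^ 2 := by field_simp
    rw [ht, abs_div, abs_of_pos hs1, div_pow, this, hs2]
  have hx2 : x ^ 2 ≤ |x| + |x| ^ 3 := by
    rw [← sq_abs]; nlinarith [abs_nonneg x, mul_nonneg (abs_nonneg x) (sq_nonneg (|x| - 1))]
  have hx3 : |x| ^ 3 ≤ |x| + |x| ^ 3 := by linarith [abs_nonneg x]
  have h1 := hX.norm_charFun_succ_sub_le (abs_le.2 ⟨ha1, by linarith⟩) hn t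
  have h2 := h (r * x)
  have hgauss : |Real.exp (-(L * (r * x) ^ 2 / 2 + t ^ 2 / 2)) - Real.exp (-(L * x ^ 2 / 2))| ≤
      x ^ 2 * (L * a ^ 2 * (1 / n) / (n + 1)) := by
    refine (abs_exp_neg_sub_exp_neg_le (by positivity) (by positivity)).trans ?_
    have hr2 : r ^ 2 = 1 - ((1 - 2 * a) - a ^ 2 / n) / (n + 1) := by linarith
    have heq : L * (r * x) ^ 2 / 2 + t ^ 2 / 2 - L * x ^ 2 / 2 =
        x ^ 2 * (L * a ^ 2 * (1 / n) / (n + 1)) / 2 := by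
      rw [mul_pow, hr2, ht2, hLdef]; field_simp; ring
    have hpos : 0 ≤ x ^ 2 * (L * a ^ 2 * (1 / n) / (n + 1)) := by positivity
    rw [heq, abs_of_nonneg (by positivity)]
    linarith
  have hE1 : Real.exp (-(t ^ 2 / 2)) ≤ 1 := Real.exp_le_one_iff.2 (by linarith [sq_nonneg t])
  have hmid : ‖(charFun (μ.map (partialSum X n)) (r * x / √n) -
      (Real.exp (-(L * (r * x) ^ 2 / 2)) : ℂ)) * (Real.exp (-(t ^ 2 / 2)) : ℂ)‖ ≤
      max r (r ^ 3) * e * (|x| + |x| ^ 3) := by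
    rw [norm_mul, Complex.norm_real, Real.norm_of_nonneg (Real.exp_pos _).le]
    refine (mul_le_of_le_one_right (norm_nonneg _) hE1).trans (h2.trans ?_)
    rw [abs_mul, abs_of_nonneg hr0]
    have e1 : r * |x| ≤ max r (r ^ 3) * |x| := by gcongr; exact le_max_left _ _
    have e2 : r ^ 3 * |x| ^ 3 ≤ max r (r ^ 3) * |x| ^ 3 := by gcongr; exact le_max_right _ _
    calc e * (r * |x| + (r * |x|) ^ 3) = e * (r * |x| + r ^ 3 * |x| ^ 3) := by ring
      _ ≤ e * (max r (r ^ 3) * |x| + max r (r ^ 3) * |x| ^ 3) := by gcongr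
      _ = _ := by ring
  rw [htr] at h1
  have hcast : x / √((n + 1 : ℕ) : ℝ) = t := by rw [ht]; push_cast; rfl
  rw [hcast]
  have hsplit : charFun (μ.map (partialSum X (n + 1))) t - (Real.exp (-(L * x ^ 2 / 2)) : ℂ) =
      (charFun (μ.map (partialSum X (n + 1))) t -
        charFun (μ.map (partialSum X n)) (r * x / √n) * (Real.exp (-(t ^ 2 / 2)) : ℂ)) +
      (charFun (μ.map (partialSum X n)) (r * x / √n) -
        (Real.exp (-(L * (r * x) ^ 2 / 2)) : ℂ)) * (Real.exp (-(t ^ 2 / 2)) : ℂ) +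
      ((Real.exp (-(L * (r * x) ^ 2 / 2 + t ^ 2 / 2)) - Real.exp (-(L * x ^ 2 / 2)) : ℝ) : ℂ) := by
    rw [neg_add, Real.exp_add]; push_cast; ring
  rw [hsplit]
  have hgauss' : ‖((Real.exp (-(L * (r * x) ^ 2 / 2 + t ^ 2 / 2)) -
      Real.exp (-(L * x ^ 2 / 2)) : ℝ) : ℂ)‖ ≤ x ^ 2 * (L * a ^ 2 * (1 / n) / (n + 1)) := by
    rw [Complex.norm_real]; exact hgauss
  refine (norm_add₃_le.trans (add_le_add (add_le_add h1 hmid) hgauss')).trans ?_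
  rw [ht2, ht3]
  have b1 : x ^ 2 * (3 * (a ^ 2 * (m / n * (1 / n))) / (n + 1) + L * a ^ 2 * (1 / n) / (n + 1)) ≤
      (|x| + |x| ^ 3) *
        (3 * (a ^ 2 * (m / n * (1 / n))) / (n + 1) + L * a ^ 2 * (1 / n) / (n + 1)) := by
    gcongr
  have b2 : |x| ^ 3 * (3 * (1 / √((n : ℝ) + 1)) / (n + 1)) ≤
      (|x| + |x| ^ 3) * (3 * (1 / √((n : ℝ) + 1)) / (n + 1)) := by
    gcongr
  have c1 : 3 * (x ^ 2 / ((n : ℝ) + 1) * (a ^ 2 * m / n ^ 2) +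
      |x| ^ 3 * (1 / √((n : ℝ) + 1)) / (n + 1)) =
      x ^ 2 * (3 * (a ^ 2 * (m / n * (1 / n))) / (n + 1)) +
      |x| ^ 3 * (3 * (1 / √((n : ℝ) + 1)) / (n + 1)) := by
    field_simp
  rw [c1, add_mul, add_div, add_div]
  linarith

lemma tendsto_charFun_div_sqrt (hX : IsElephantWalk μ a X) (ha1 : -1 ≤ a) (ha : a < 1 / 2)
    (x : ℝ) :
    Tendsto (fun n : ℕ => charFun (μ.map (partialSum X n)) (x / √n)) atTop
      (𝓝 (Real.exp (-(1 / (1 - 2 * a) * x ^ 2 / 2)) : ℂ)) := by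
  have hL : 0 < 1 - 2 * a := by linarith
  set L := 1 / (1 - 2 * a) with hLdef
  have hL0 : 0 < L := by positivity
  let δ : ℕ → ℝ := fun n => 3 * (a ^ 2 * ((∫ ω, partialSum X n ω ^ 2 ∂μ) / n * (1 / n))) +
    3 * (1 / √(n + 1)) + L * a ^ 2 * (1 / n)
  have hδ0 : ∀ n, 0 ≤ δ n := fun n => by
    have : 0 ≤ ∫ ω, partialSum X n ω ^ 2 ∂μ := integral_nonneg fun ω => sq_nonneg _
    positivity
  have hδ : Tendsto δ atTop (𝓝 0) := by
    have t1 : Tendsto (fun n : ℕ => 1 / (n : ℝ)) atTop (𝓝 0) :=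
      tendsto_const_div_atTop_nhds_zero_nat _
    have t2 : Tendsto (fun n : ℕ => 1 / √((n : ℝ) + 1)) atTop (𝓝 0) :=
      tendsto_const_nhds.div_atTop (Real.tendsto_sqrt_atTop.comp
        (tendsto_atTop_add_const_right _ _ tendsto_natCast_atTop_atTop))
    have t3 := ((((hX.tendsto_integral_partialSum_sq_div ha).mul t1).const_mul
      (a ^ 2)).const_mul 3).add (t2.const_mul 3) |>.add (t1.const_mul (L * a ^ 2))
    simpa only [mul_zero, add_zero] using t3
  let ρ : ℕ → ℝ := fun n => max (elephantScale a n) (elephantScale a n ^ 3)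
  let e : ℕ → ℝ := fun n => Nat.rec (motive := fun _ => ℝ) 0
    (fun n en => if n = 0 then 1 + L else ρ n * en + δ n / (n + 1)) n
  have hesucc : ∀ n, 1 ≤ n → e (n + 1) = ρ n * e n + δ n / (n + 1) := fun n hn =>
    if_neg (by omega)
  have hρ0 : ∀ n, 1 ≤ n → 0 ≤ ρ n := fun n hn =>
    (elephantScale_nonneg ha1 hn).trans (le_max_left _ _)
  have he0 : ∀ n, 0 ≤ e n := by
    intro n
    induction n with
    | zero => exact le_rfl
    | succ n ih =>
      rcases Nat.eq_zero_or_pos n with rfl | hn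
      · change 0 ≤ 1 + L; positivity
      · rw [hesucc n hn]
        exact add_nonneg (mul_nonneg (hρ0 n hn) ih) (div_nonneg (hδ0 n) (by positivity))
  have hlim : Tendsto e atTop (𝓝 0) := by
    refine tendsto_zero_of_eventually_le_contraction (δ := δ) (κ := (1 - 2 * a) / 4)
      (by linarith) he0 hδ ?_
    filter_upwards [eventually_ge_atTop 1, eventually_elephantScale_le ha] with n hn h
    rw [hesucc n hn]
    have hr0 := elephantScale_nonneg ha1 hn
    have hr1 : elephantScale a n ≤ 1 := by
      refine h.trans (sub_le_self _ ?_); positivity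
    have hρ : ρ n ≤ 1 - (1 - 2 * a) / 4 / (n + 1) :=
      max_le h ((pow_le_of_le_one hr0 hr1 (by norm_num)).trans h)
    gcongr
    exact he0 n
  have hmain : ∀ n, 1 ≤ n → ∀ x : ℝ, ‖charFun (μ.map (partialSum X n)) (x / √n) -
      (Real.exp (-(L * x ^ 2 / 2)) : ℂ)‖ ≤ e n * (|x| + |x| ^ 3) := by
    intro n hn
    induction n, hn using Nat.le_induction with
    | base =>
      intro x
      have hlaw : charFun (μ.map (partialSum X 1)) (x / √(1 : ℕ)) =
          Complex.exp (Complex.I * x) := by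
        rw [charFun_apply_real, integral_map (hX.measurable_partialSum 1).aemeasurable
          (Continuous.aestronglyMeasurable (by fun_prop))]
        rw [integral_congr_ae (g := fun _ => Complex.exp (Complex.I * x))]
        · simp
        · filter_upwards [hX.first_step] with ω hω
          simp [partialSum, hω, mul_comm]
      have h1 : ‖Complex.exp (Complex.I * x) - 1‖ ≤ |x| := Real.norm_exp_I_mul_ofReal_sub_one_le
      have h2 : ‖(1 : ℂ) - (Real.exp (-(L * x ^ 2 / 2)) : ℂ)‖ ≤ L * x ^ 2 / 2 := by
        have := abs_exp_neg_sub_exp_neg_le (le_refl (0 : ℝ))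
          (show 0 ≤ L * x ^ 2 / 2 by positivity)
        rw [neg_zero, Real.exp_zero, zero_sub, abs_neg,
          abs_of_nonneg (show 0 ≤ L * x ^ 2 / 2 by positivity)] at this
        exact_mod_cast this
      have hx2 : x ^ 2 ≤ |x| + |x| ^ 3 := by
        rw [← sq_abs]
        nlinarith [abs_nonneg x, mul_nonneg (abs_nonneg x) (sq_nonneg (|x| - 1))]
      rw [hlaw, ← sub_add_sub_cancel _ (1 : ℂ)]
      refine (norm_add_le_of_le h1 h2).trans ?_
      change _ ≤ (1 + L) * (|x| + |x| ^ 3)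
      have := mul_le_mul_of_nonneg_left hx2 hL0.le
      have := mul_nonneg hL0.le (sq_nonneg x)
      have := pow_nonneg (abs_nonneg x) 3
      linarith
    | succ n hn ih =>
      intro x
      rw [hesucc n hn]
      exact hX.norm_charFun_div_sqrt_succ_sub_le ha1 ha hn (he0 n) ih x
  rw [tendsto_iff_norm_sub_tendsto_zero]
  refine squeeze_zero' (Eventually.of_forall fun n => norm_nonneg _) ?_
    (by simpa using hlim.mul_const (|x| + |x| ^ 3))
  filter_upwards [eventually_ge_atTop 1] with n hn using hmain n hn x

/-- The central limit theorem for the diffusive elephant random walk. -/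
theorem tendstoInDistribution_div_sqrt (hX : IsElephantWalk μ a X) (ha1 : -1 ≤ a)
    (ha : a < 1 / 2) :
    TendstoInDistribution μ (fun n ω => partialSum X n ω / √n)
      (gaussianReal 0 (Real.toNNReal (1 / (1 - 2 * a)))) := by
  have hL : 0 < 1 - 2 * a := by linarith
  have hmeas : ∀ n : ℕ, Measurable fun ω => partialSum X n ω / √n := fun n =>
    (hX.measurable_partialSum n).div_const _
  let ν : ℕ → ProbabilityMeasure ℝ := fun n =>
    ⟨μ.map (fun ω => partialSum X n ω / √n), Measure.isProbabilityMeasure_map (hmeas n).aemeasurable⟩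
  let γ : ProbabilityMeasure ℝ := ⟨gaussianReal 0 (Real.toNNReal (1 / (1 - 2 * a))), inferInstance⟩
  have hν : Tendsto ν atTop (𝓝 γ) := by
    refine ProbabilityMeasure.tendsto_of_tendsto_charFun fun x => ?_
    have hγ : charFun (γ : Measure ℝ) x =
        (Real.exp (-(1 / (1 - 2 * a) * x ^ 2 / 2)) : ℂ) := by
      change charFun (gaussianReal 0 (Real.toNNReal (1 / (1 - 2 * a)))) x = _
      rw [charFun_gaussianReal, Real.coe_toNNReal _ (by positivity)]
      push_cast
      congr 1
      ring
    have hchar : ∀ n : ℕ, charFun (ν n : Measure ℝ) x =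
        charFun (μ.map (partialSum X n)) (x / √n) := fun n => by
      change charFun (μ.map (fun ω => partialSum X n ω / √n)) x = _
      rw [charFun_apply_real, charFun_apply_real,
        integral_map (hmeas n).aemeasurable (Continuous.aestronglyMeasurable (by fun_prop)),
        integral_map (hX.measurable_partialSum n).aemeasurable
          (Continuous.aestronglyMeasurable (by fun_prop))]
      refine integral_congr_ae (Eventually.of_forall fun ω => ?_)
      simp only
      congr 1
      push_cast
      ring
    simp_rw [hchar, hγ]
    exact hX.tendsto_charFun_div_sqrt ha1 ha x
  intro g
  have := ProbabilityMeasure.tendsto_iff_forall_integral_tendsto.1 hν g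
  refine this.congr fun n => ?_
  exact integral_map (hmeas n).aemeasurable g.continuous.aestronglyMeasurable

end IsElephantWalk

/-- Multiplying by an independent factor preserves convergence in distribution. -/
lemma TendstoInDistribution.mul_of_indepFun {Ω : Type*} [MeasurableSpace Ω] {μ : Measure Ω}
    [IsProbabilityMeasure μ] {W : ℕ → Ω → ℝ} {R : Ω → ℝ} {γ : Measure ℝ} [IsProbabilityMeasure γ]
    (h : TendstoInDistribution μ W γ) (hW : ∀ n, Measurable (W n)) (hR : Measurable R)
    (hind : ∀ n, IndepFun R (W n) μ) :
    TendstoInDistribution μ (fun n ω => R ω * W n ω)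
      (((μ.map R).prod γ).map fun q : ℝ × ℝ => q.1 * q.2) := by
  have hRp : IsProbabilityMeasure (μ.map R) := Measure.isProbabilityMeasure_map hR.aemeasurable
  intro g
  have hgm : Continuous fun q : ℝ × ℝ => g (q.1 * q.2) := by fun_prop
  have hdis : ∀ (ρ : Measure ℝ) [IsProbabilityMeasure ρ],
      ∫ q, g (q.1 * q.2) ∂((μ.map R).prod ρ) = ∫ r, ∫ w, g (r * w) ∂ρ ∂(μ.map R) := fun ρ _ => by
    refine integral_prod (fun q : ℝ × ℝ => g (q.1 * q.2)) ?_
    exact Integrable.of_bound hgm.aestronglyMeasurable ‖g‖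
      (Eventually.of_forall fun q => g.norm_coe_le_norm _)
  have hWp : ∀ n, IsProbabilityMeasure (μ.map (W n)) := fun n =>
    Measure.isProbabilityMeasure_map (hW n).aemeasurable
  have hn : ∀ n, ∫ ω, g (R ω * W n ω) ∂μ = ∫ r, ∫ w, g (r * w) ∂(μ.map (W n)) ∂(μ.map R) := by
    intro n
    rw [← hdis, ← (hind n).map_prod_eq_prod_map_map hR.aemeasurable (hW n).aemeasurable,
      integral_map (hR.prodMk (hW n)).aemeasurable hgm.aestronglyMeasurable]
  rw [integral_map (by fun_prop) g.continuous.aestronglyMeasurable, hdis]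
  simp_rw [hn]
  refine tendsto_integral_of_dominated_convergence (fun _ => ‖g‖) (fun n => ?_)
    (integrable_const _) (fun n => Eventually.of_forall fun r => ?_)
    (Eventually.of_forall fun r => ?_)
  · exact (hgm.stronglyMeasurable.integral_prod_right
      (f := fun r w => g (r * w))).aestronglyMeasurable
  · refine (norm_integral_le_of_norm_le_const
      (Eventually.of_forall fun w => g.norm_coe_le_norm _)).trans_eq ?_
    simp
  · have := h (g.compContinuous ⟨fun w => r * w, by fun_prop⟩)
    refine this.congr fun n => ?_
    rw [integral_map (hW n).aemeasurable (Continuous.aestronglyMeasurable (by fun_prop))]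
    rfl

/-- in the diffusive regime `0 < p < 3/4` of the full-memory elephant random
walk with general step size `Sₙ = R·S̃ₙ`, the ratio `Sₙ/√n` converges in distribution to
`R·Z` with `Z ∼ N(0, 1/(3-4p))` independent of `R` (the limit law is the distribution of
`(t, z) ↦ t·z` under `law(R) ⊗ N(0, 1/(3-4p))`).  Moreover, if `E(R²) < ∞`, then
`E(Sₙ/√n) → 0` and `E((Sₙ/√n)²) → E(R²)/(3-4p)`. -/
theorem elephant_general_diffusive_clt
    {Ω : Type*} [MeasurableSpace Ω] (μ : Measure Ω) [IsProbabilityMeasure μ]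
    (p : ℝ) (hp0 : 0 < p) (hp1 : p < 3/4)
    (X : ℕ → Ω → ℝ) (R : Ω → ℝ)
    (hXmeas : ∀ i, Measurable (X i)) (hRmeas : Measurable R)
    (hval : ∀ i, 1 ≤ i → ∀ᵐ ω ∂μ, X i ω = 1 ∨ X i ω = -1)
    (hinit : ∀ᵐ ω ∂μ, X 1 ω = 1)
    (hcond : ∀ n, 1 ≤ n →
      μ[X (n+1) | sigmaUpTo X n] =ᵐ[μ]
        fun ω => (2*p-1) * partialSum X n ω / n)
    (hRindep : Indep (MeasurableSpace.comap R inferInstance) (sigmaAll X) μ) :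
    TendstoInDistribution μ
      (fun n ω => R ω * partialSum X n ω / Real.sqrt n)
      (((μ.map R).prod (gaussianReal 0 (Real.toNNReal (1/(3-4*p))))).map
        (fun q : ℝ × ℝ => q.1 * q.2)) ∧
    (Integrable (fun ω => (R ω)^2) μ →
      Tendsto (fun n : ℕ => ∫ ω, R ω * partialSum X n ω / Real.sqrt n ∂μ) atTop (𝓝 0) ∧
      Tendsto (fun n : ℕ => ∫ ω, (R ω * partialSum X n ω / Real.sqrt n)^2 ∂μ) atTop
        (𝓝 ((∫ ω, (R ω)^2 ∂μ) / (3-4*p)))) := by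
  have hX : IsElephantWalk μ (2 * p - 1) X := ⟨hXmeas, hval, hinit, hcond⟩
  have ha1 : -1 ≤ 2 * p - 1 := by linarith
  have ha : 2 * p - 1 < 1 / 2 := by linarith
  have hden : 1 - 2 * (2 * p - 1) = 3 - 4 * p := by ring
  have hindS : ∀ n, IndepFun R (partialSum X n) μ := fun n =>
    indep_of_indep_of_le_right hRindep (measurable_partialSum_sigmaAll X n).comap_le
  have hS := hX.measurable_partialSum
  refine ⟨?_, fun hR2 => ⟨?_, ?_⟩⟩
  · have h := (hX.tendstoInDistribution_div_sqrt ha1 ha).mul_of_indepFun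
      (fun n => (hS n).div_const _) hRmeas
      (fun n => (hindS n).comp measurable_id (measurable_id.div_const (√(n : ℝ))))
    simpa only [hden, mul_div_assoc] using h
  · have h := (hX.tendsto_integral_partialSum_div_sqrt ha1 ha).const_mul (∫ ω, R ω ∂μ)
    rw [mul_zero] at h
    refine h.congr fun n => ?_
    rw [integral_div, (hindS n).integral_fun_mul_eq_mul_integral hRmeas.aestronglyMeasurable
      (hS n).aestronglyMeasurable, mul_div_assoc]
  · have h := (hX.tendsto_integral_partialSum_sq_div ha).const_mul (∫ ω, R ω ^ 2 ∂μ)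
    rw [hden, mul_one_div] at h
    refine h.congr fun n => ?_
    have hsq : ∀ ω, (R ω * partialSum X n ω / √n) ^ 2 =
        R ω ^ 2 * partialSum X n ω ^ 2 / n := fun ω => by
      rw [div_pow, mul_pow, Real.sq_sqrt (Nat.cast_nonneg n)]
    simp_rw [hsq]
    have hind2 : IndepFun (fun ω => R ω ^ 2) (fun ω => partialSum X n ω ^ 2) μ :=
      (hindS n).comp (measurable_id.pow_const 2) (measurable_id.pow_const 2)
    rw [integral_div, hind2.integral_fun_mul_eq_mul_integral
      (hRmeas.pow_const 2).aestronglyMeasurable ((hS n).pow_const 2).aestronglyMeasurable,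
      mul_div_assoc]
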